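/- Let P ⊆ ℝ³ be a lattice polytope and let Z = A + n₁E₁ + ⋯ + n_l E_l ⊆ P be a smallest maximal Minkowski decomposition. Then for any three primitive direction vectors v_i, v_j, v_k of segments E_i, E_j, E_k in Z, we have |det(v_i, v_j, v_k)| ≤ 2. -/

import Mathlib

open Pointwise

/-- The real point corresponding to a lattice point. -/
def coeV {n : ℕ} (v : Fin n → ℤ) : Fin n → ℝ := fun i => (v i : ℝ)

/-- A vector in `ℤ^n` is primitive if the gcd of its coordinates is `1`. -/
def IsPrim {n : ℕ} (v : Fin n → ℤ) : Prop := Finset.univ.gcd v = 1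

/-- The zonotope with base lattice point `A` obtained as the Minkowski sum of the
lattice segments `[0, v i]`. -/
def Zono {n L : ℕ} (A : Fin n → ℤ) (v : Fin L → Fin n → ℤ) : Set (Fin n → ℝ) :=
  ({coeV A} : Set (Fin n → ℝ)) + ∑ i, segment ℝ 0 (coeV (v i))

/-- `P` contains (a translate of) a Minkowski sum of `L` primitive lattice segments. -/
def IsDecomp {n : ℕ} (P : Set (Fin n → ℝ)) (L : ℕ) : Prop :=
  ∃ (A : Fin n → ℤ) (v : Fin L → Fin n → ℤ), (∀ i, IsPrim (v i)) ∧ Zono A v ⊆ P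

/-- `L` is the Minkowski length of `P`. -/
def MinkLen {n : ℕ} (P : Set (Fin n → ℝ)) (L : ℕ) : Prop :=
  IsDecomp P L ∧ ∀ M, IsDecomp P M → M ≤ L

/-- `P` is a lattice polytope: the convex hull of a nonempty finite set of lattice points. -/
def IsLatticePolytope {n : ℕ} (P : Set (Fin n → ℝ)) : Prop :=
  ∃ S : Finset (Fin n → ℤ), S.Nonempty ∧ P = convexHull ℝ (coeV '' ↑S)

/-- `Zono A v` is a smallest maximal Minkowski decomposition in `P`: it realizes the
Minkowski length of `P` and is minimal with respect to inclusion among all maximal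
decompositions in `P`. -/
def IsSmallestMax {n L : ℕ} (P : Set (Fin n → ℝ)) (A : Fin n → ℤ)
    (v : Fin L → Fin n → ℤ) : Prop :=
  (∀ i, IsPrim (v i)) ∧ Zono A v ⊆ P ∧ MinkLen P L ∧
    ∀ (B : Fin n → ℤ) (w : Fin L → Fin n → ℤ), (∀ i, IsPrim (w i)) →
      Zono B w ⊆ P → Zono B w ⊆ Zono A v → Zono B w = Zono A v

theorem mem_Zono {n L : ℕ} {A : Fin n → ℤ} {v : Fin L → Fin n → ℤ} {x : Fin n → ℝ} :
    x ∈ Zono A v ↔ ∃ t : Fin L → ℝ, (∀ i, t i ∈ Set.Icc (0 : ℝ) 1) ∧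
      x = coeV A + ∑ i, t i • coeV (v i) := by
  simp only [Zono, Set.singleton_add, Set.mem_image, Set.mem_fintype_sum, segment_eq_image',
    sub_zero, zero_add]
  constructor
  · rintro ⟨_, ⟨g, hg, rfl⟩, rfl⟩
    choose t ht hgt using hg
    exact ⟨t, ht, by simp [hgt]⟩
  · rintro ⟨t, ht, rfl⟩
    exact ⟨_, ⟨fun i => t i • coeV (v i), fun i => ⟨t i, ht i, rfl⟩, rfl⟩, rfl⟩

theorem coeV_dotProduct {n : ℕ} (u c : Fin n → ℤ) :
    coeV u ⬝ᵥ coeV c = ((u ⬝ᵥ c : ℤ) : ℝ) := by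
  simp [dotProduct, coeV]

/-- Inclusion of zonotopes is reflected by their widths in every lattice direction. -/
theorem sum_abs_dotProduct_le_of_Zono_subset {n L : ℕ} {A B : Fin n → ℤ}
    {v w : Fin L → Fin n → ℤ} (h : Zono A v ⊆ Zono B w) (c : Fin n → ℤ) :
    ∑ i, |v i ⬝ᵥ c| ≤ ∑ i, |w i ⬝ᵥ c| := by
  obtain ⟨s, hs, hs'⟩ := mem_Zono.1 (h (mem_Zono.2
    ⟨fun i => if 0 ≤ v i ⬝ᵥ c then 1 else 0, fun i => by dsimp only; split_ifs <;> simp, rfl⟩))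
  obtain ⟨t, ht, ht'⟩ := mem_Zono.1 (h (mem_Zono.2
    ⟨fun i => if 0 ≤ v i ⬝ᵥ c then 0 else 1, fun i => by dsimp only; split_ifs <;> simp, rfl⟩))
  have hs2 := congrArg (· ⬝ᵥ coeV c) hs'
  have ht2 := congrArg (· ⬝ᵥ coeV c) ht'
  simp only [add_dotProduct, sum_dotProduct, smul_dotProduct, coeV_dotProduct, smul_eq_mul]
    at hs2 ht2
  have h1 : ∑ i, |((v i ⬝ᵥ c : ℤ) : ℝ)| =
      ∑ i, (if 0 ≤ v i ⬝ᵥ c then (1 : ℝ) else 0) * ((v i ⬝ᵥ c : ℤ) : ℝ) -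
      ∑ i, (if 0 ≤ v i ⬝ᵥ c then (0 : ℝ) else 1) * ((v i ⬝ᵥ c : ℤ) : ℝ) := by
    rw [← Finset.sum_sub_distrib]
    refine Finset.sum_congr rfl fun i _ => ?_
    split_ifs with hi
    · rw [abs_of_nonneg (by exact_mod_cast hi)]; ring
    · rw [abs_of_neg (by exact_mod_cast not_le.1 hi)]; ring
  have h2 : ∑ i, s i * ((w i ⬝ᵥ c : ℤ) : ℝ) - ∑ i, t i * ((w i ⬝ᵥ c : ℤ) : ℝ) ≤
      ∑ i, |((w i ⬝ᵥ c : ℤ) : ℝ)| := by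
    rw [← Finset.sum_sub_distrib]
    refine Finset.sum_le_sum fun i _ => ?_
    rw [← sub_mul]
    refine (le_abs_self _).trans ?_
    rw [abs_mul]
    refine mul_le_of_le_one_left (abs_nonneg _) (abs_le.2 ⟨?_, ?_⟩) <;>
      linarith [(hs i).1, (hs i).2, (ht i).1, (ht i).2]
  have h3 : ∑ i, |((v i ⬝ᵥ c : ℤ) : ℝ)| ≤ ∑ i, |((w i ⬝ᵥ c : ℤ) : ℝ)| := by linarith
  exact_mod_cast h3

theorem exists_isPrim_smul {n : ℕ} {u : Fin n → ℤ} (hu : u ≠ 0) :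
    ∃ (g : ℤ) (w : Fin n → ℤ), 0 < g ∧ IsPrim w ∧ u = g • w := by
  obtain ⟨i, hi⟩ := Function.ne_iff.1 hu
  obtain ⟨w, hw, hw'⟩ := Finset.univ.extract_gcd u ⟨i, Finset.mem_univ i⟩
  refine ⟨Finset.univ.gcd u, w, lt_of_le_of_ne ?_ ?_, hw', ?_⟩
  · exact Int.nonneg_of_normalize_eq_self Finset.normalize_gcd
  · intro h
    exact hi (Finset.gcd_eq_zero_iff.1 h.symm i (Finset.mem_univ i))
  · ext j
    exact hw j (Finset.mem_univ j)

theorem Fintype.sum_sub_sum_comp_eq {ι κ G : Type*} [Fintype ι] [Fintype κ] [AddCommGroup G]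
    {e : κ → ι} (he : Function.Injective e) {f g : ι → G}
    (h : ∀ i ∉ Set.range e, f i = g i) :
    ∑ i, f i - ∑ k, f (e k) = ∑ i, g i - ∑ k, g (e k) := by
  have := Fintype.sum_of_injective e he (fun k => f (e k) - g (e k)) (fun i => f i - g i)
    (fun i hi => sub_eq_zero.2 (h i hi)) (fun _ => rfl)
  simp only [Finset.sum_sub_distrib] at this
  rw [sub_eq_sub_iff_sub_eq_sub, this]

section Parallelepiped

variable {n : ℕ} (M : Matrix (Fin n) (Fin n) ℤ)

theorem Matrix.vecMul_adjugate_vecMul (u : Fin n → ℤ) :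
    Matrix.vecMul (Matrix.vecMul u M.adjugate) M = M.det • u := by
  rw [Matrix.vecMul_vecMul, Matrix.adjugate_mul, Matrix.vecMul_smul, Matrix.vecMul_one]

theorem Matrix.vecMul_vecMul_adjugate (u : Fin n → ℤ) :
    Matrix.vecMul (Matrix.vecMul u M) M.adjugate = M.det • u := by
  rw [Matrix.vecMul_vecMul, Matrix.mul_adjugate, Matrix.vecMul_smul, Matrix.vecMul_one]

/-- Every coset of the lattice spanned by the rows of `M`, other than the lattice itself, has a
representative in the half-open parallelepiped spanned by the rows. -/
theorem exists_coset_representative (hM : 0 < M.det) {r : Fin n → ℤ}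
    (hr : r ∉ Submodule.span ℤ (Set.range M.row)) :
    ∃ p : Fin n → ℤ, r - p ∈ Submodule.span ℤ (Set.range M.row) ∧
      (∀ i, Matrix.vecMul p M.adjugate i ∈ Set.Icc 0 M.det) ∧
      ∃ i, Matrix.vecMul p M.adjugate i ∈ Set.Ioo 0 M.det := by
  set f : Fin n → ℤ := fun i => Matrix.vecMul r M.adjugate i / M.det with hf
  have hN : Matrix.vecMul f M ∈ Submodule.span ℤ (Set.range M.row) := by
    rw [← range_vecMulLinear]
    exact ⟨f, rfl⟩
  have hp : ∀ i, Matrix.vecMul (r - Matrix.vecMul f M) M.adjugate i =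
      Matrix.vecMul r M.adjugate i % M.det := by
    intro i
    rw [Matrix.sub_vecMul, Matrix.vecMul_vecMul_adjugate]
    simp only [Pi.sub_apply, Pi.smul_apply, smul_eq_mul, hf, Int.emod_def]
  have hnn : ∀ i, 0 ≤ Matrix.vecMul r M.adjugate i % M.det := fun i => Int.emod_nonneg _ hM.ne'
  have hlt : ∀ i, Matrix.vecMul r M.adjugate i % M.det < M.det := fun i => Int.emod_lt_of_pos _ hM
  refine ⟨r - Matrix.vecMul f M, by simpa using hN, fun i => ?_, ?_⟩
  · rw [hp]
    exact ⟨hnn i, (hlt i).le⟩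
  · by_contra! hcon
    have h0 : Matrix.vecMul (r - Matrix.vecMul f M) M.adjugate = 0 := by
      ext i
      by_contra hne
      refine hcon i ?_
      rw [hp] at hne ⊢
      exact ⟨lt_of_le_of_ne (hnn i) (Ne.symm hne), hlt i⟩
    have h1 := Matrix.vecMul_adjugate_vecMul M (r - Matrix.vecMul f M)
    rw [h0, Matrix.zero_vecMul, eq_comm, smul_eq_zero, or_iff_right hM.ne', sub_eq_zero] at h1
    exact hr (h1 ▸ hN)

theorem exists_lattice_points_of_three_le_det (hM : 3 ≤ M.det) :
    ∃ p q : Fin n → ℤ, p ≠ q ∧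
      (∀ i, Matrix.vecMul p M.adjugate i ∈ Set.Icc 0 M.det) ∧
      (∀ i, Matrix.vecMul q M.adjugate i ∈ Set.Icc 0 M.det) ∧
      (∃ i, Matrix.vecMul p M.adjugate i ∈ Set.Ioo 0 M.det) ∧
      ∃ i, Matrix.vecMul q M.adjugate i ∈ Set.Ioo 0 M.det := by
  have hD : 0 < M.det := by omega
  set N := Submodule.span ℤ (Set.range M.row)
  have hli : LinearIndependent ℤ M.row := Matrix.linearIndependent_rows_of_det_ne_zero hD.ne'
  have hcard : M.det.natAbs = Nat.card ((Fin n → ℤ) ⧸ N) := by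
    rw [← Submodule.natAbs_det_basis_change (Pi.basisFun ℤ (Fin n)) N (Module.Basis.span hli)]
    have hrow : (Subtype.val ∘ Module.Basis.span hli) = M.row :=
      funext fun i => congrArg Subtype.val (Module.Basis.span_apply hli i)
    rw [hrow, Pi.basisFun_det_apply]
    rfl
  have hfin : Finite ((Fin n → ℤ) ⧸ N) := Nat.finite_of_card_ne_zero (by omega)
  have := Fintype.ofFinite ((Fin n → ℤ) ⧸ N)
  rw [Nat.card_eq_fintype_card] at hcard
  obtain ⟨x, y, z, hxy, hxz, hyz⟩ := Fintype.two_lt_card_iff.1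
    (show 2 < Fintype.card ((Fin n → ℤ) ⧸ N) by omega)
  induction x using Submodule.Quotient.induction_on with | _ x
  induction y using Submodule.Quotient.induction_on with | _ y
  induction z using Submodule.Quotient.induction_on with | _ z
  rw [Ne, Submodule.Quotient.eq] at hxy hxz hyz
  obtain ⟨p, hp, hp1, hp2⟩ := exists_coset_representative M hD hxz
  obtain ⟨q, hq, hq1, hq2⟩ := exists_coset_representative M hD hyz
  refine ⟨p, q, ?_, hp1, hq1, hp2, hq2⟩
  rintro rfl
  apply hxy
  have := N.sub_mem hp hq
  convert this using 1
  abel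

theorem coeV_vecMul (f : Fin n → ℤ) :
    coeV (Matrix.vecMul f M) = ∑ i, (f i : ℝ) • coeV (M i) := by
  ext j
  simp [coeV, Matrix.vecMul, dotProduct]

theorem monotone_path_mem_Icc {x y : ℝ} (hx : 0 ≤ x) (hxy : x ≤ y) (hy : y ≤ 1)
    {s : Fin 3 → ℝ} (hs : ∀ k, s k ∈ Set.Icc (0 : ℝ) 1) :
    s 0 * x + s 1 * (y - x) + s 2 * (1 - y) ∈ Set.Icc (0 : ℝ) 1 := by
  have h0 := hs 0
  have h1 := hs 1
  have h2 := hs 2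
  have hxy' := sub_nonneg.2 hxy
  have hy' := sub_nonneg.2 hy
  constructor
  · have := mul_nonneg h0.1 hx
    have := mul_nonneg h1.1 hxy'
    have := mul_nonneg h2.1 hy'
    linarith
  · have := mul_le_of_le_one_left hx h0.2
    have := mul_le_of_le_one_left hxy' h1.2
    have := mul_le_of_le_one_left hy' h2.2
    linarith

/-- A parallelepiped with two distinct lattice points other than its vertices contains a
zonotope spanned by three nonzero lattice segments, following a coordinatewise monotone path
from a vertex through the two points to the opposite vertex. -/
theorem exists_three_segments (hM : 0 < M.det) {p q : Fin n → ℤ} (hpq : p ≠ q)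
    (hp : ∀ i, Matrix.vecMul p M.adjugate i ∈ Set.Icc 0 M.det)
    (hq : ∀ i, Matrix.vecMul q M.adjugate i ∈ Set.Icc 0 M.det)
    (hp' : ∃ i, Matrix.vecMul p M.adjugate i ∈ Set.Ioo 0 M.det)
    (hq' : ∃ i, Matrix.vecMul q M.adjugate i ∈ Set.Ioo 0 M.det) :
    ∃ (V : Fin n → ℤ) (u : Fin 3 → Fin n → ℤ), (∀ k, u k ≠ 0) ∧
      (∀ s : Fin 3 → ℝ, (∀ k, s k ∈ Set.Icc (0 : ℝ) 1) → ∃ t : Fin n → ℝ,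
        (∀ i, t i ∈ Set.Icc (0 : ℝ) 1) ∧
        coeV V + ∑ k, s k • coeV (u k) = ∑ i, t i • coeV (M i)) ∧
      (∀ i, ∑ k, |Matrix.vecMul (u k) M.adjugate i| = M.det) ∧
      ∃ i, |Matrix.vecMul (u 0) M.adjugate i| ∈ Set.Ioo 0 M.det := by
  set P := Matrix.vecMul p M.adjugate
  set Q := Matrix.vecMul q M.adjugate
  set ε : Fin n → ℤ := fun i => if P i ≤ Q i then 0 else 1 with hε
  have h0 : Matrix.vecMul (p - Matrix.vecMul ε M) M.adjugate = P - M.det • ε := by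
    rw [Matrix.sub_vecMul, Matrix.vecMul_vecMul_adjugate]
  have h1 : Matrix.vecMul (q - p) M.adjugate = Q - P := by
    rw [Matrix.sub_vecMul]
  have h2 : Matrix.vecMul (Matrix.vecMul (1 - ε) M - q) M.adjugate = M.det • (1 - ε) - Q := by
    rw [Matrix.sub_vecMul, Matrix.vecMul_vecMul_adjugate]
  refine ⟨Matrix.vecMul ε M, ![p - Matrix.vecMul ε M, q - p, Matrix.vecMul (1 - ε) M - q],
    ?_, ?_, ?_, ?_⟩
  · obtain ⟨i, hi⟩ := hp'
    obtain ⟨j, hj⟩ := hq'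
    intro k
    fin_cases k
    · intro h
      simp only [Fin.zero_eta, Matrix.cons_val_zero] at h
      rw [h, Matrix.zero_vecMul] at h0
      have := congrFun h0 i
      simp only [hε, Pi.zero_apply, Pi.sub_apply, Pi.smul_apply, smul_eq_mul] at this
      split_ifs at this <;> linarith [hi.1, hi.2]
    · simpa [sub_eq_zero] using hpq.symm
    · intro h
      simp only [Fin.reduceFinMk, Matrix.cons_val] at h
      rw [h, Matrix.zero_vecMul] at h2
      have := congrFun h2 j
      simp only [hε, Pi.zero_apply, Pi.sub_apply, Pi.smul_apply, smul_eq_mul, Pi.one_apply] at this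
      split_ifs at this <;> linarith [hj.1, hj.2]
  · intro s hs
    have hDR : (0 : ℝ) < M.det := by exact_mod_cast hM
    refine ⟨fun i => ε i + ∑ k, s k * (Matrix.vecMul (![p - Matrix.vecMul ε M, q - p,
      Matrix.vecMul (1 - ε) M - q] k) M.adjugate i / M.det), fun i => ?_, ?_⟩
    · obtain ⟨hp0, hp1⟩ := hp i
      obtain ⟨hq0, hq1⟩ := hq i
      simp only [Fin.sum_univ_three, Matrix.cons_val_zero, Matrix.cons_val_one, Matrix.cons_val,
        h0, h1, h2, Pi.sub_apply, Pi.smul_apply, smul_eq_mul, Pi.one_apply, Int.cast_sub,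
        Int.cast_mul, sub_div, mul_div_cancel_left₀ _ hDR.ne', Int.cast_one]
      have hP0 : (0 : ℝ) ≤ P i / M.det := div_nonneg (by exact_mod_cast hp0) hDR.le
      have hQ0 : (0 : ℝ) ≤ Q i / M.det := div_nonneg (by exact_mod_cast hq0) hDR.le
      have hP1 : (P i / M.det : ℝ) ≤ 1 := (div_le_one hDR).2 (by exact_mod_cast hp1)
      have hQ1 : (Q i / M.det : ℝ) ≤ 1 := (div_le_one hDR).2 (by exact_mod_cast hq1)
      by_cases hPQ : P i ≤ Q i
      · have hPQ' : (P i / M.det : ℝ) ≤ Q i / M.det :=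
          div_le_div_of_nonneg_right (by exact_mod_cast hPQ) hDR.le
        simpa [hε, hPQ] using monotone_path_mem_Icc hP0 hPQ' hQ1 hs
      · have hPQ' : (Q i / M.det : ℝ) ≤ P i / M.det :=
          div_le_div_of_nonneg_right (by exact_mod_cast (not_le.1 hPQ).le) hDR.le
        have := monotone_path_mem_Icc (sub_nonneg.2 hP1) (sub_le_sub_left hPQ' 1)
          (sub_le_self 1 hQ0) hs
        simp only [hε, hPQ, if_false, Set.mem_Icc, Int.cast_one] at this ⊢
        constructor <;> linarith [this.1, this.2]
    · simp only [add_smul, Finset.sum_add_distrib, Finset.sum_smul, ← coeV_vecMul]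
      rw [Finset.sum_comm, add_right_inj]
      refine Finset.sum_congr rfl fun k _ => ?_
      simp only [mul_smul, div_eq_inv_mul]
      rw [← Finset.smul_sum, ← Finset.smul_sum, ← coeV_vecMul, Matrix.vecMul_adjugate_vecMul]
      congr 1
      ext j
      simp [coeV, hDR.ne']
  · intro i
    simp only [Fin.sum_univ_three, Matrix.cons_val_zero, Matrix.cons_val_one, Matrix.cons_val,
      h0, h1, h2]
    have hp := hp i
    have hq := hq i
    simp only [hε, Pi.sub_apply, Pi.smul_apply, smul_eq_mul, Pi.one_apply, Set.mem_Icc] at hp hq ⊢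
    split_ifs <;> simp only [abs_eq_max_neg] <;> omega
  · obtain ⟨i, hi⟩ := hp'
    refine ⟨i, ?_⟩
    simp only [Matrix.cons_val_zero, h0]
    simp only [hε, Pi.sub_apply, Pi.smul_apply, smul_eq_mul, Set.mem_Ioo] at hi ⊢
    split_ifs <;> simp only [abs_eq_max_neg] <;> omega

end Parallelepiped

theorem eq_zero_of_forall_abs_signed_sum_eq {x y z : ℤ}
    (h : ∀ ε δ : ℤ, |ε| = 1 → |δ| = 1 → |x + ε * y + δ * z| = |x| + |y| + |z|) :
    (y = 0 ∧ z = 0) ∨ (x = 0 ∧ z = 0) ∨ (x = 0 ∧ y = 0) := by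
  have h1 := h 1 1 rfl rfl
  have h2 := h 1 (-1) rfl rfl
  have h3 := h (-1) 1 rfl rfl
  have h4 := h (-1) (-1) rfl rfl
  simp only [abs_eq_max_neg] at *
  omega

theorem abs_signed_sum_le {x y z ε δ : ℤ} (hε : |ε| = 1) (hδ : |δ| = 1) :
    |x + ε * y + δ * z| ≤ |x| + |y| + |z| := by
  refine (abs_add_three _ _ _).trans ?_
  rw [abs_mul, abs_mul, hε, hδ, one_mul, one_mul]

/-- Three vectors whose zonotope fits into the cube of side `D` and has the same width in every
diagonal direction are the edges of that cube. -/
theorem not_mem_Ioo_of_signed_widths {D : ℤ} {x : Fin 3 → Fin 3 → ℤ}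
    (hx : ∀ i, ∑ k, |x k i| = D)
    (hw : ∀ ε δ : ℤ, |ε| = 1 → |δ| = 1 → 3 * D ≤ ∑ k, |x k 0 + ε * x k 1 + δ * x k 2|) (i : Fin 3) :
    |x 0 i| ∉ Set.Ioo 0 D := by
  have key : ∀ k, (|x k 1| = 0 ∧ |x k 2| = 0) ∨ (|x k 0| = 0 ∧ |x k 2| = 0) ∨
      (|x k 0| = 0 ∧ |x k 1| = 0) := by
    intro k
    simp only [abs_eq_zero]
    refine eq_zero_of_forall_abs_signed_sum_eq fun ε δ hε hδ => ?_
    have hle : ∀ k ∈ Finset.univ, |x k 0 + ε * x k 1 + δ * x k 2| ≤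
        |x k 0| + |x k 1| + |x k 2| := fun k _ => abs_signed_sum_le hε hδ
    refine (Finset.sum_eq_sum_iff_of_le hle).1 (le_antisymm (Finset.sum_le_sum hle) ?_) k
      (Finset.mem_univ k)
    rw [Finset.sum_add_distrib, Finset.sum_add_distrib, hx, hx, hx]
    linarith [hw ε δ hε hδ]
  have k0 := key 0
  have k1 := key 1
  have k2 := key 2
  have x0 := hx 0
  have x1 := hx 1
  have x2 := hx 2
  rw [Fin.sum_univ_three] at x0 x1 x2
  suffices h : |x 0 0| ∉ Set.Ioo 0 D ∧ |x 0 1| ∉ Set.Ioo 0 D ∧ |x 0 2| ∉ Set.Ioo 0 D by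
    fin_cases i
    exacts [h.1, h.2.1, h.2.2]
  simp only [Set.mem_Ioo]
  clear hx hw key
  generalize |x 0 0| = x00, |x 0 1| = x01, |x 0 2| = x02, |x 1 0| = x10, |x 1 1| = x11,
    |x 1 2| = x12, |x 2 0| = x20, |x 2 1| = x21, |x 2 2| = x22 at *
  omega

theorem det_lt_three_of_isSmallestMax {L : ℕ} {P : Set (Fin 3 → ℝ)} {A : Fin 3 → ℤ}
    {v : Fin L → Fin 3 → ℤ} (h : IsSmallestMax P A v) (e : Fin 3 → Fin L) :
    (Matrix.of (v ∘ e)).det < 3 := by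
  by_contra! hM
  set M := Matrix.of (v ∘ e) with hMdef
  have hD : 0 < M.det := by omega
  have he : Function.Injective e := by
    intro i j hij
    by_contra hne
    exact hD.ne' (Matrix.det_zero_of_row_eq hne (by ext; simp [hMdef, hij]))
  obtain ⟨p, q, hpq, hp, hq, hp', hq'⟩ := exists_lattice_points_of_three_le_det M hM
  obtain ⟨V, u, hu, hsub, hsum, i, hi⟩ := exists_three_segments M hD hpq hp hq hp' hq'
  choose g w hg hw huw using fun k => exists_isPrim_smul (hu k)
  obtain ⟨hv, hP, -, hmin⟩ := h
  set w' : Fin L → Fin 3 → ℤ := Function.extend e w v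
  have hw'e : ∀ k, w' (e k) = w k := fun k => he.extend_apply _ _ _
  have hw'v : ∀ m ∉ Set.range e, w' m = v m := fun m hm => Function.extend_apply' _ _ _ hm
  have hprim : ∀ m, IsPrim (w' m) := by
    intro m
    by_cases hm : m ∈ Set.range e
    · obtain ⟨k, rfl⟩ := hm
      rw [hw'e]
      exact hw k
    · rw [hw'v m hm]
      exact hv m
  have hcont : Zono (A + V) w' ⊆ Zono A v := by
    intro x hx
    obtain ⟨t, ht, rfl⟩ := mem_Zono.1 hx
    have hg1 : ∀ k, (1 : ℝ) ≤ g k := fun k => by exact_mod_cast hg k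
    obtain ⟨r, hr, hrs⟩ := hsub (fun k => t (e k) / g k) fun k =>
      ⟨div_nonneg (ht _).1 (by linarith [hg1 k]),
        div_le_one_of_le₀ ((ht _).2.trans (hg1 k)) (by linarith [hg1 k])⟩
    have hre : ∀ k, Function.extend e r t (e k) = r k := fun k => he.extend_apply _ _ _
    have hrt : ∀ m ∉ Set.range e, Function.extend e r t m = t m :=
      fun m hm => Function.extend_apply' _ _ _ hm
    refine mem_Zono.2 ⟨Function.extend e r t, fun m => ?_, ?_⟩
    · by_cases hm : m ∈ Set.range e
      · obtain ⟨k, rfl⟩ := hm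
        rw [hre]
        exact hr k
      · rw [hrt m hm]
        exact ht m
    · have hA : coeV (A + V) = coeV A + coeV V := by ext; simp [coeV]
      have hs := Fintype.sum_sub_sum_comp_eq he
        (f := fun m => t m • coeV (w' m)) (g := fun m => Function.extend e r t m • coeV (v m))
        fun m hm => by simp only [hw'v m hm, hrt m hm]
      simp only [hw'e, hre] at hs
      have hsc : ∀ k, (t (e k) / g k) • coeV (u k) = t (e k) • coeV (w k) := by
        intro k
        rw [huw k]
        ext j
        have : (g k : ℝ) ≠ 0 := by linarith [hg1 k]
        simp [coeV]
        field_simp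
      simp only [hsc] at hrs
      change _ = ∑ k, r k • coeV (v (e k)) at hrs
      rw [← hrs] at hs
      rw [hA, add_assoc, add_right_inj, ← sub_eq_zero]
      rw [← sub_eq_zero] at hs
      rw [← hs]
      abel
  have heq := hmin (A + V) w' hprim (hcont.trans hP) hcont
  refine not_mem_Ioo_of_signed_widths hsum (fun ε δ hε hδ => ?_) i hi
  set c := Matrix.mulVec M.adjugate ![1, ε, δ] with hc
  have hcu : ∀ y, y ⬝ᵥ c = Matrix.vecMul y M.adjugate 0 + ε * Matrix.vecMul y M.adjugate 1 +
      δ * Matrix.vecMul y M.adjugate 2 := by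
    intro y
    rw [hc, Matrix.dotProduct_mulVec]
    simp [dotProduct, Fin.sum_univ_three]
    ring
  have hle := sum_abs_dotProduct_le_of_Zono_subset heq.ge c
  have hs := Fintype.sum_sub_sum_comp_eq he (f := fun m => |v m ⬝ᵥ c|)
    (g := fun m => |w' m ⬝ᵥ c|) fun m hm => by simp only [hw'v m hm]
  simp only [hw'e] at hs
  have hve : ∀ k, |v (e k) ⬝ᵥ c| = M.det := by
    intro k
    have h1 : v (e k) = Matrix.vecMul (Pi.single k 1) M := by
      rw [Matrix.single_one_vecMul]
      rfl
    rw [hcu, h1, Matrix.vecMul_vecMul_adjugate]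
    fin_cases k <;> simp [abs_mul, hε, hδ, abs_of_pos hD]
  have hwu : ∀ k, |w k ⬝ᵥ c| ≤ |u k ⬝ᵥ c| := by
    intro k
    rw [huw k, smul_dotProduct, smul_eq_mul, abs_mul]
    refine le_mul_of_one_le_left (abs_nonneg _) ?_
    rw [abs_of_pos (hg k)]
    exact hg k
  have hsumw := Finset.sum_le_sum fun k (_ : k ∈ Finset.univ) => hwu k
  simp only [hve, Finset.sum_const, Finset.card_univ, Fintype.card_fin, nsmul_eq_mul] at hs
  simp only [← hcu]
  push_cast at hs
  linarith

/-- In a smallest maximal Minkowski decomposition of a 3D lattice polytope, any three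
primitive direction vectors span a parallelepiped of volume at most 2. -/
theorem stmt6 {L : ℕ} (P : Set (Fin 3 → ℝ)) (hP : IsLatticePolytope P)
    (A : Fin 3 → ℤ) (v : Fin L → Fin 3 → ℤ) (h : IsSmallestMax P A v) :
    ∀ i j k, |(Matrix.of ![v i, v j, v k]).det| ≤ 2 := by
  intro i j k
  have h1 := det_lt_three_of_isSmallestMax h ![i, j, k]
  have h2 := det_lt_three_of_isSmallestMax h ![i, k, j]
  simp only [Matrix.det_fin_three, Matrix.of_apply, Function.comp_apply, Matrix.cons_val_zero,
    Matrix.cons_val_one, Matrix.cons_val] at h1 h2 ⊢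
  rw [abs_le]
  constructor <;> linarith
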